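/- arXiv:2110.13615 — 2 statements merged into one kernel-verified Lean document; each statement's English description precedes it below -/
import Mathlib

section
/- The symmedian point of the second CCP solution triangle T2 coincides with the Gergonne point of the reference triangle ABC: the point with barycentric coordinates [x²:y²:z²] with respect to (W1,W2,W3), where x = dist(W2,W3), y = dist(W3,W1), z = dist(W1,W2), equals the point with barycentric coordinates [1/u : 1/v : 1/w] with respect to (A,B,C). -/
open EuclideanGeometry

/-- The point with barycentric coordinates `[x : y : z]` with respect to `(A, B, C)`. -/
noncomputable def bary (A B C : EuclideanSpace ℝ (Fin 2)) (x y z : ℝ) :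
    EuclideanSpace ℝ (Fin 2) :=
  (x + y + z)⁻¹ • (x • A + y • B + z • C)

lemma bary_rotate (A B C : EuclideanSpace ℝ (Fin 2)) (x y z : ℝ) :
    bary A B C x y z = bary B C A y z x := by
  simp only [bary, show y + z + x = x + y + z by ring]
  congr 1
  abel

lemma bary_mul (A B C : EuclideanSpace ℝ (Fin 2)) {k : ℝ} (hk : k ≠ 0) (x y z : ℝ) :
    bary A B C (k * x) (k * y) (k * z) = bary A B C x y z := by
  simp only [bary, ← mul_add, mul_smul, ← smul_add, mul_inv]
  rw [smul_comm, inv_smul_smul₀ hk, smul_add, smul_add]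

/-- A barycentric combination of barycentric points, each weighted by a multiple of its
total mass. -/
lemma bary_bary (A B C : EuclideanSpace ℝ (Fin 2)) {x₁ y₁ z₁ x₂ y₂ z₂ x₃ y₃ z₃ : ℝ}
    (h₁ : x₁ + y₁ + z₁ ≠ 0) (h₂ : x₂ + y₂ + z₂ ≠ 0) (h₃ : x₃ + y₃ + z₃ ≠ 0) (k l m : ℝ) :
    bary (bary A B C x₁ y₁ z₁) (bary A B C x₂ y₂ z₂) (bary A B C x₃ y₃ z₃)
        (k * (x₁ + y₁ + z₁)) (l * (x₂ + y₂ + z₂)) (m * (x₃ + y₃ + z₃)) =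
      bary A B C (k * x₁ + l * x₂ + m * x₃) (k * y₁ + l * y₂ + m * y₃)
        (k * z₁ + l * z₂ + m * z₃) := by
  simp only [bary, mul_smul, smul_inv_smul₀ h₁, smul_inv_smul₀ h₂, smul_inv_smul₀ h₃]
  rw [show k * x₁ + l * x₂ + m * x₃ + (k * y₁ + l * y₂ + m * y₃) + (k * z₁ + l * z₂ + m * z₃) =
    k * (x₁ + y₁ + z₁) + l * (x₂ + y₂ + z₂) + m * (x₃ + y₃ + z₃) by ring]
  congr 1
  module

/-- The squared distance between two points with barycentric coordinates differing only in the
first entry. -/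
lemma dist_bary_sq (A B C : EuclideanSpace ℝ (Fin 2)) {x x' y z : ℝ}
    (h : x + y + z ≠ 0) (h' : x' + y + z ≠ 0) :
    dist (bary A B C x y z) (bary A B C x' y z) ^ 2 =
      ((x - x') / ((x + y + z) * (x' + y + z))) ^ 2 *
        (y ^ 2 * dist A B ^ 2 + z ^ 2 * dist C A ^ 2 +
          y * z * (dist A B ^ 2 + dist C A ^ 2 - dist B C ^ 2)) := by
  have hsub : bary A B C x y z - bary A B C x' y z =
      ((x - x') / ((x + y + z) * (x' + y + z))) • (y • (A - B) + z • (A - C)) := by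
    simp only [bary]
    match_scalars <;> field_simp <;> ring
  have hBC : dist B C = ‖(A - B) - (A - C)‖ := by rw [dist_comm, dist_eq_norm]; congr 1; abel
  rw [dist_eq_norm, hsub, norm_smul, mul_pow, Real.norm_eq_abs, sq_abs, hBC, dist_eq_norm A B,
    dist_comm C A, dist_eq_norm A C, norm_add_sq_real, norm_sub_sq_real (A - B) (A - C),
    norm_smul, norm_smul,
    inner_smul_left, inner_smul_right, mul_pow, mul_pow, Real.norm_eq_abs, Real.norm_eq_abs,
    sq_abs, sq_abs]
  simp only [conj_trivial]
  ring

/-- For a root `t` of `t ^ 2 = 3 * t - 1`, scaling the first barycentric coordinate of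
`[1 / u : t / v : t ^ 2 / w]` by `t ^ 3` moves the point by a squared distance inversely
proportional to the product of the two total masses. -/
lemma dist_bary_geometric_sq {A B C : EuclideanSpace ℝ (Fin 2)} {u v w t : ℝ}
    (hu : 0 < u) (hv : 0 < v) (hw : 0 < w) (ht : 0 < t) (ht2 : t ^ 2 = 3 * t - 1)
    (hBC : dist B C = v + w) (hCA : dist C A = w + u) (hAB : dist A B = u + v) :
    dist (bary A B C (1 / u) (t / v) (t ^ 2 / w)) (bary A B C (t ^ 3 / u) (t / v) (t ^ 2 / w)) ^ 2 =
      (t ^ 3 - 1) ^ 2 /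
        ((1 / u + t / v + t ^ 2 / w) * (t ^ 3 / u + t / v + t ^ 2 / w)) := by
  have key : (t / v) ^ 2 * (u + v) ^ 2 + (t ^ 2 / w) ^ 2 * (w + u) ^ 2 +
      t / v * (t ^ 2 / w) * ((u + v) ^ 2 + (w + u) ^ 2 - (v + w) ^ 2) =
      u ^ 2 * ((1 / u + t / v + t ^ 2 / w) * (t ^ 3 / u + t / v + t ^ 2 / w)) := by
    field_simp
    linear_combination (t * v ^ 2 * w ^ 2 - (t + 1) * u * (w + t * v) * v * w) * ht2
  have h₁ : 1 / u + t / v + t ^ 2 / w ≠ 0 := by positivity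
  have h₂ : t ^ 3 / u + t / v + t ^ 2 / w ≠ 0 := by positivity
  rw [dist_bary_sq A B C h₁ h₂, hBC, hCA, hAB, key]
  generalize 1 / u + t / v + t ^ 2 / w = D at *
  generalize t ^ 3 / u + t / v + t ^ 2 / w = E at *
  field_simp
  ring

lemma dist_lt_add_of_not_collinear {A B C : EuclideanSpace ℝ (Fin 2)}
    (h : ¬ Collinear ℝ {A, B, C}) : dist A C < dist A B + dist B C :=
  dist_lt_dist_add_dist_iff.2 fun hw => h hw.collinear

/-- The symmedian point of the second CCP solution triangle `T2 = (W1, W2, W3)` coincides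
with the Gergonne point of the reference triangle `ABC`. -/
theorem ccp_second_solution_symmedian_eq_gergonne
    (A B C : EuclideanSpace ℝ (Fin 2)) (hABC : AffineIndependent ℝ ![A, B, C])
    (a b c s u v w φ : ℝ)
    (ha : a = dist B C) (hb : b = dist C A) (hc : c = dist A B)
    (hs : s = (a + b + c) / 2)
    (hu : u = s - a) (hv : v = s - b) (hw : w = s - c)
    (hφ : φ = (1 + Real.sqrt 5) / 2)
    (W1 W2 W3 : EuclideanSpace ℝ (Fin 2))
    (hW1 : W1 = bary A B C (1 / u) (φ ^ 2 / v) ((φ + 1) ^ 2 / w))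
    (hW2 : W2 = bary A B C ((2 * φ + 1) ^ 2 / u) (φ ^ 2 / v) ((φ + 1) ^ 2 / w))
    (hW3 : W3 = bary A B C ((2 * φ + 1) ^ 2 / u) ((3 * φ + 2) ^ 2 / v) ((φ + 1) ^ 2 / w))
    (x y z : ℝ)
    (hx : x = dist W2 W3) (hy : y = dist W3 W1) (hz : z = dist W1 W2) :
    bary W1 W2 W3 (x ^ 2) (y ^ 2) (z ^ 2) = bary A B C (1 / u) (1 / v) (1 / w) := by
  rw [affineIndependent_iff_not_collinear_set] at hABC
  have hu0 : 0 < u := by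
    have := dist_lt_add_of_not_collinear (A := B) (B := A) (C := C)
      (by rwa [Set.insert_comm])
    linarith [dist_comm A B, dist_comm A C]
  have hv0 : 0 < v := by
    have := dist_lt_add_of_not_collinear (A := C) (B := B) (C := A)
      (by rwa [Set.pair_comm, Set.insert_comm, Set.pair_comm])
    linarith [dist_comm A B, dist_comm B C]
  have hw0 : 0 < w := by
    have := dist_lt_add_of_not_collinear (A := A) (B := C) (C := B)
      (by rwa [Set.pair_comm])
    linarith [dist_comm B C, dist_comm A C]
  have hφ0 : 0 < φ := by rw [hφ]; positivity
  have hφ2 : φ ^ 2 = φ + 1 := by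
    rw [hφ]; linear_combination (1 / 4) * Real.sq_sqrt (show (0 : ℝ) ≤ 5 by norm_num)
  obtain ⟨t, ht⟩ : ∃ t, t = φ ^ 2 := ⟨_, rfl⟩
  have ht0 : 0 < t := by rw [ht]; positivity
  have ht2 : t ^ 2 = 3 * t - 1 := by rw [ht]; grind
  have e₁ : (φ + 1) ^ 2 = t ^ 2 := by rw [ht, hφ2]
  have e₂ : (2 * φ + 1) ^ 2 = t ^ 3 := by grind
  have e₃ : (3 * φ + 2) ^ 2 = t ^ 4 := by grind
  rw [← ht, e₁] at hW1
  rw [← ht, e₁, e₂] at hW2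
  rw [e₁, e₂, e₃] at hW3
  have hBC : dist B C = v + w := by linarith
  have hCA : dist C A = w + u := by linarith
  have hAB : dist A B = u + v := by linarith
  have hz2 := dist_bary_geometric_sq hu0 hv0 hw0 ht0 ht2 hBC hCA hAB
  have hx2 := dist_bary_geometric_sq hv0 hw0 hu0 ht0 ht2 hCA hAB hBC
  have hy2 := dist_bary_geometric_sq hw0 hu0 hv0 ht0 ht2 hAB hBC hCA
  have hBCA₂ : bary B C A (1 / v) (t / w) (t ^ 2 / u) = W2 := by
    rw [hW2, bary_rotate A, ← bary_mul B C A ht0.ne' (1 / v)]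
    congr 1 <;> ring
  have hBCA₃ : bary B C A (t ^ 3 / v) (t / w) (t ^ 2 / u) = W3 := by
    rw [hW3, bary_rotate A, ← bary_mul B C A ht0.ne' (t ^ 3 / v)]
    congr 1 <;> ring
  have hCAB₃ : bary C A B (1 / w) (t / u) (t ^ 2 / v) = W3 := by
    rw [hW3, ← bary_rotate C, ← bary_mul C A B (pow_pos ht0 2).ne' (1 / w)]
    congr 1 <;> ring
  have hCAB₁ : bary C A B (t ^ 3 / w) (t / u) (t ^ 2 / v) = W1 := by
    rw [hW1, ← bary_rotate C, ← bary_mul C A B ht0.ne' (t ^ 2 / w)]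
    congr 1 <;> ring
  rw [hBCA₂, hBCA₃, ← hx] at hx2
  rw [hCAB₃, hCAB₁, ← hy] at hy2
  rw [← hW1, ← hW2, ← hz] at hz2
  have hD₁ : 0 < 1 / u + t / v + t ^ 2 / w := by positivity
  have hD₂ : 0 < t ^ 3 / u + t / v + t ^ 2 / w := by positivity
  have hD₃ : 0 < t ^ 3 / u + t ^ 4 / v + t ^ 2 / w := by positivity
  have ht3 : t ^ 3 - 1 ≠ 0 := by
    intro h
    nlinarith [show 8 * t = 4 by linear_combination h - (t + 3) * ht2]
  obtain ⟨K, hK⟩ : ∃ K, K = (t ^ 3 - 1) ^ 2 / ((1 / u + t / v + t ^ 2 / w) *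
    (t ^ 3 / u + t / v + t ^ 2 / w) * (t ^ 3 / u + t ^ 4 / v + t ^ 2 / w)) := ⟨_, rfl⟩
  have hK0 : K ≠ 0 := by
    rw [hK]
    exact div_ne_zero (pow_ne_zero 2 ht3) (by positivity)
  have hxK : x ^ 2 = K * (t ^ 2 * (1 / u + t / v + t ^ 2 / w)) := by
    rw [hx2, hK, show 1 / v + t / w + t ^ 2 / u = (t ^ 3 / u + t / v + t ^ 2 / w) / t by
        field_simp; ring,
      show t ^ 3 / v + t / w + t ^ 2 / u = (t ^ 3 / u + t ^ 4 / v + t ^ 2 / w) / t by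
        field_simp; ring]
    field_simp
  have hyK : y ^ 2 = K * (t * (t ^ 3 / u + t / v + t ^ 2 / w)) := by
    rw [hy2, hK, show 1 / w + t / u + t ^ 2 / v = (t ^ 3 / u + t ^ 4 / v + t ^ 2 / w) / t ^ 2 by
        field_simp; ring,
      show t ^ 3 / w + t / u + t ^ 2 / v = (1 / u + t / v + t ^ 2 / w) * t by field_simp; ring]
    field_simp
  have hzK : z ^ 2 = K * (1 * (t ^ 3 / u + t ^ 4 / v + t ^ 2 / w)) := by
    rw [hz2, hK]
    field_simp
  have hm : t ^ 2 + t ^ 3 + t ^ 4 ≠ 0 := by positivity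
  rw [hxK, hyK, hzK, bary_mul _ _ _ hK0, hW1, hW2, hW3, bary_bary A B C hD₁.ne' hD₂.ne' hD₃.ne',
    ← bary_mul A B C hm (1 / u)]
  congr 1 <;> ring
end

section
/- The two CCP solution triangles T1 and T2 share their isodynamic points: the set {P : x1·dist(P,V1) = y1·dist(P,V2) = z1·dist(P,V3)} equals the set {P : x2·dist(P,W1) = y2·dist(P,W2) = z2·dist(P,W3)}, where x1 = dist(V2,V3), y1 = dist(V3,V1), z1 = dist(V1,V2) and x2 = dist(W2,W3), y2 = dist(W3,W1), z2 = dist(W1,W2). -/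
open EuclideanGeometry

/-- A strict triangle inequality for the vertices of a nondegenerate triangle. -/
theorem dist_lt_dist_add_dist_of_affineIndependent {A B C : EuclideanSpace ℝ (Fin 2)}
    (h : AffineIndependent ℝ ![A, B, C]) : dist A C < dist A B + dist B C := by
  refine lt_of_le_of_ne (dist_triangle A B C) fun heq => ?_
  exact affineIndependent_iff_not_collinear_set.mp h (dist_add_dist_eq_iff.mp heq.symm).collinear

/-- The squared distance from a point to a point given in barycentric coordinates. -/
theorem mul_dist_sq_bary (P A B C : EuclideanSpace ℝ (Fin 2)) {x y z : ℝ} (h : x + y + z ≠ 0) :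
    (x + y + z) ^ 2 * dist P (bary A B C x y z) ^ 2 =
      (x + y + z) * (x * dist P A ^ 2 + y * dist P B ^ 2 + z * dist P C ^ 2) -
        (y * z * dist B C ^ 2 + z * x * dist C A ^ 2 + x * y * dist A B ^ 2) := by
  simp only [EuclideanSpace.dist_sq_eq, Fin.sum_univ_two, Real.dist_eq, sq_abs, bary,
    PiLp.smul_apply, PiLp.add_apply, smul_eq_mul]
  field_simp
  ring

/-- The squared distance from a point to a point of the incircle, the latter being given by the
barycentric coordinates `[p² / u : q² / v : r² / w]` with `p + q + r = 0`. -/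
theorem mul_dist_sq_bary_incircle (P A B C : EuclideanSpace ℝ (Fin 2)) {u v w p q r : ℝ}
    (hu : 0 < u) (hv : 0 < v) (hw : 0 < w) (ha : dist B C = v + w) (hb : dist C A = w + u)
    (hc : dist A B = u + v) (hpqr : p + q + r = 0) (hN : 0 < p ^ 2 / u + q ^ 2 / v + r ^ 2 / w) :
    (p ^ 2 / u + q ^ 2 / v + r ^ 2 / w) *
        dist P (bary A B C (p ^ 2 / u) (q ^ 2 / v) (r ^ 2 / w)) ^ 2 =
      p ^ 2 * (dist P A ^ 2 / u - u) + q ^ 2 * (dist P B ^ 2 / v - v) +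
        r ^ 2 * (dist P C ^ 2 / w - w) := by
  have key := mul_dist_sq_bary P A B C hN.ne'
  rw [ha, hb, hc] at key
  apply mul_left_cancel₀ hN.ne'
  rw [← mul_assoc, ← sq, key]
  obtain rfl : r = -p - q := by linarith
  field_simp
  ring

/-- The squared length of a chord of the incircle, in terms of the parameters of its ends. -/
theorem mul_dist_sq_incircle_chord (A B C : EuclideanSpace ℝ (Fin 2))
    {u v w p q r p' q' r' : ℝ}
    (hu : 0 < u) (hv : 0 < v) (hw : 0 < w) (ha : dist B C = v + w) (hb : dist C A = w + u)
    (hc : dist A B = u + v) (hpqr : p + q + r = 0) (hpqr' : p' + q' + r' = 0)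
    (hN : 0 < p ^ 2 / u + q ^ 2 / v + r ^ 2 / w)
    (hN' : 0 < p' ^ 2 / u + q' ^ 2 / v + r' ^ 2 / w) :
    (p ^ 2 / u + q ^ 2 / v + r ^ 2 / w) * (p' ^ 2 / u + q' ^ 2 / v + r' ^ 2 / w) *
        dist (bary A B C (p ^ 2 / u) (q ^ 2 / v) (r ^ 2 / w))
          (bary A B C (p' ^ 2 / u) (q' ^ 2 / v) (r' ^ 2 / w)) ^ 2 =
      4 * (p * q' - p' * q) ^ 2 := by
  have key := fun P => mul_dist_sq_bary_incircle P A B C hu hv hw ha hb hc hpqr hN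
  have hA := key A
  have hB := key B
  have hC := key C
  have hX := mul_dist_sq_bary_incircle (bary A B C (p ^ 2 / u) (q ^ 2 / v) (r ^ 2 / w))
    A B C hu hv hw ha hb hc hpqr' hN'
  set X := bary A B C (p ^ 2 / u) (q ^ 2 / v) (r ^ 2 / w)
  simp only [dist_self, dist_comm A C, dist_comm B A, dist_comm C B, ha, hb, hc,
    dist_comm _ X] at hA hB hC
  rw [mul_assoc, hX]
  generalize hNdef : p ^ 2 / u + q ^ 2 / v + r ^ 2 / w = N at *
  have hA' : N * (dist X A ^ 2 / u - u) = -4 * (q * r) := by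
    rw [mul_sub, ← mul_div_assoc, hA, ← hNdef]
    obtain rfl : r = -p - q := by linarith
    field_simp
    ring
  have hB' : N * (dist X B ^ 2 / v - v) = -4 * (p * r) := by
    rw [mul_sub, ← mul_div_assoc, hB, ← hNdef]
    obtain rfl : r = -p - q := by linarith
    field_simp
    ring
  have hC' : N * (dist X C ^ 2 / w - w) = -4 * (p * q) := by
    rw [mul_sub, ← mul_div_assoc, hC, ← hNdef]
    obtain rfl : r = -p - q := by linarith
    field_simp
    ring
  obtain rfl : r = -p - q := by linarith
  obtain rfl : r' = -p' - q' := by linarith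
  linear_combination p' ^ 2 * hA' + q' ^ 2 * hB' + (-p' - q') ^ 2 * hC'

/-- The squared product of a side of a triangle inscribed in the incircle and the distance from a
point to the opposite vertex, up to a factor symmetric in the three vertices. -/
theorem mul_sq_chord_mul_dist (P A B C : EuclideanSpace ℝ (Fin 2))
    {u v w p₁ q₁ r₁ p₂ q₂ r₂ p₃ q₃ r₃ : ℝ}
    (hu : 0 < u) (hv : 0 < v) (hw : 0 < w) (ha : dist B C = v + w) (hb : dist C A = w + u)
    (hc : dist A B = u + v)
    (h₁ : p₁ + q₁ + r₁ = 0) (h₂ : p₂ + q₂ + r₂ = 0) (h₃ : p₃ + q₃ + r₃ = 0)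
    (hN₁ : 0 < p₁ ^ 2 / u + q₁ ^ 2 / v + r₁ ^ 2 / w)
    (hN₂ : 0 < p₂ ^ 2 / u + q₂ ^ 2 / v + r₂ ^ 2 / w)
    (hN₃ : 0 < p₃ ^ 2 / u + q₃ ^ 2 / v + r₃ ^ 2 / w) :
    (p₁ ^ 2 / u + q₁ ^ 2 / v + r₁ ^ 2 / w) * (p₂ ^ 2 / u + q₂ ^ 2 / v + r₂ ^ 2 / w) *
        (p₃ ^ 2 / u + q₃ ^ 2 / v + r₃ ^ 2 / w) *
        (dist (bary A B C (p₂ ^ 2 / u) (q₂ ^ 2 / v) (r₂ ^ 2 / w))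
          (bary A B C (p₃ ^ 2 / u) (q₃ ^ 2 / v) (r₃ ^ 2 / w)) *
          dist P (bary A B C (p₁ ^ 2 / u) (q₁ ^ 2 / v) (r₁ ^ 2 / w))) ^ 2 =
      4 * ((p₂ * q₃ - p₃ * q₂) ^ 2 *
        (p₁ ^ 2 * (dist P A ^ 2 / u - u) + q₁ ^ 2 * (dist P B ^ 2 / v - v) +
          r₁ ^ 2 * (dist P C ^ 2 / w - w))) := by
  have hd := mul_dist_sq_bary_incircle P A B C hu hv hw ha hb hc h₁ hN₁
  have hch := mul_dist_sq_incircle_chord A B C hu hv hw ha hb hc h₂ h₃ hN₂ hN₃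
  rw [← hd]
  linear_combination (p₁ ^ 2 / u + q₁ ^ 2 / v + r₁ ^ 2 / w) *
    dist P (bary A B C (p₁ ^ 2 / u) (q₁ ^ 2 / v) (r₁ ^ 2 / w)) ^ 2 * hch

theorem eq_iff_of_mul_sq_eq {k m n s t : ℝ} (hk : 0 < k) (hm : 0 ≤ m) (hn : 0 ≤ n)
    (hs : k * m ^ 2 = 4 * s) (ht : k * n ^ 2 = 4 * t) : m = n ↔ s = t := by
  constructor
  · rintro rfl
    linarith
  · rintro rfl
    exact (sq_eq_sq₀ hm hn).mp (mul_left_cancel₀ hk.ne' (hs.trans ht.symm))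

/-- The isodynamic points of a triangle inscribed in the incircle, in terms of the parameters of
its vertices. -/
theorem isodynamic_incircle_iff (P A B C : EuclideanSpace ℝ (Fin 2))
    {u v w p₁ q₁ r₁ p₂ q₂ r₂ p₃ q₃ r₃ : ℝ} {V₁ V₂ V₃ : EuclideanSpace ℝ (Fin 2)}
    (hu : 0 < u) (hv : 0 < v) (hw : 0 < w) (ha : dist B C = v + w) (hb : dist C A = w + u)
    (hc : dist A B = u + v)
    (h₁ : p₁ + q₁ + r₁ = 0) (h₂ : p₂ + q₂ + r₂ = 0) (h₃ : p₃ + q₃ + r₃ = 0)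
    (hr₁ : r₁ ≠ 0) (hr₂ : r₂ ≠ 0) (hr₃ : r₃ ≠ 0)
    (hV₁ : V₁ = bary A B C (p₁ ^ 2 / u) (q₁ ^ 2 / v) (r₁ ^ 2 / w))
    (hV₂ : V₂ = bary A B C (p₂ ^ 2 / u) (q₂ ^ 2 / v) (r₂ ^ 2 / w))
    (hV₃ : V₃ = bary A B C (p₃ ^ 2 / u) (q₃ ^ 2 / v) (r₃ ^ 2 / w)) :
    (dist V₂ V₃ * dist P V₁ = dist V₃ V₁ * dist P V₂ ∧
      dist V₃ V₁ * dist P V₂ = dist V₁ V₂ * dist P V₃) ↔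
    ((p₂ * q₃ - p₃ * q₂) ^ 2 *
        (p₁ ^ 2 * (dist P A ^ 2 / u - u) + q₁ ^ 2 * (dist P B ^ 2 / v - v) +
          r₁ ^ 2 * (dist P C ^ 2 / w - w)) =
      (p₃ * q₁ - p₁ * q₃) ^ 2 *
        (p₂ ^ 2 * (dist P A ^ 2 / u - u) + q₂ ^ 2 * (dist P B ^ 2 / v - v) +
          r₂ ^ 2 * (dist P C ^ 2 / w - w)) ∧
      (p₃ * q₁ - p₁ * q₃) ^ 2 *
        (p₂ ^ 2 * (dist P A ^ 2 / u - u) + q₂ ^ 2 * (dist P B ^ 2 / v - v) +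
          r₂ ^ 2 * (dist P C ^ 2 / w - w)) =
      (p₁ * q₂ - p₂ * q₁) ^ 2 *
        (p₃ ^ 2 * (dist P A ^ 2 / u - u) + q₃ ^ 2 * (dist P B ^ 2 / v - v) +
          r₃ ^ 2 * (dist P C ^ 2 / w - w))) := by
  have hN₁ : 0 < p₁ ^ 2 / u + q₁ ^ 2 / v + r₁ ^ 2 / w := by positivity
  have hN₂ : 0 < p₂ ^ 2 / u + q₂ ^ 2 / v + r₂ ^ 2 / w := by positivity
  have hN₃ : 0 < p₃ ^ 2 / u + q₃ ^ 2 / v + r₃ ^ 2 / w := by positivity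
  have e₁ := mul_sq_chord_mul_dist P A B C hu hv hw ha hb hc h₁ h₂ h₃ hN₁ hN₂ hN₃
  have e₂ := mul_sq_chord_mul_dist P A B C hu hv hw ha hb hc h₂ h₃ h₁ hN₂ hN₃ hN₁
  have e₃ := mul_sq_chord_mul_dist P A B C hu hv hw ha hb hc h₃ h₁ h₂ hN₃ hN₁ hN₂
  rw [← hV₁, ← hV₂, ← hV₃] at e₁ e₂ e₃
  rw [mul_rotate (p₂ ^ 2 / u + q₂ ^ 2 / v + r₂ ^ 2 / w),
    mul_rotate (p₃ ^ 2 / u + q₃ ^ 2 / v + r₃ ^ 2 / w)] at e₂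
  rw [mul_rotate (p₃ ^ 2 / u + q₃ ^ 2 / v + r₃ ^ 2 / w)] at e₃
  have hk := mul_pos (mul_pos hN₁ hN₂) hN₃
  exact and_congr (eq_iff_of_mul_sq_eq hk (by positivity) (by positivity) e₁ e₂)
    (eq_iff_of_mul_sq_eq hk (by positivity) (by positivity) e₂ e₃)

/-- The isodynamic points of the first inscribed golden triangle. -/
theorem golden_isodynamic_iff {φ f g h : ℝ} (hφ : φ ^ 2 = φ + 1) :
    (((φ - 2) * (2 * φ - 3) - (2 - φ) * 1) ^ 2 *
        (φ ^ 2 * f + (-1) ^ 2 * g + (1 - φ) ^ 2 * h) =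
      ((2 - φ) * (-1) - φ * (2 * φ - 3)) ^ 2 *
        ((φ - 2) ^ 2 * f + 1 ^ 2 * g + (1 - φ) ^ 2 * h) ∧
      ((2 - φ) * (-1) - φ * (2 * φ - 3)) ^ 2 *
        ((φ - 2) ^ 2 * f + 1 ^ 2 * g + (1 - φ) ^ 2 * h) =
      (φ * 1 - (φ - 2) * (-1)) ^ 2 *
        ((2 - φ) ^ 2 * f + (2 * φ - 3) ^ 2 * g + (1 - φ) ^ 2 * h)) ↔ f = h ∧ g = h := by
  constructor
  · rintro ⟨h₁, h₂⟩
    constructor <;> grind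
  · rintro ⟨rfl, rfl⟩
    constructor <;> grind

/-- The isodynamic points of the second inscribed golden triangle. -/
theorem golden_isodynamic_iff' {φ f g h : ℝ} (hφ : φ ^ 2 = φ + 1) :
    (((2 * φ + 1) * -(3 * φ + 2) - (2 * φ + 1) * -φ) ^ 2 *
        (1 ^ 2 * f + φ ^ 2 * g + (-(φ + 1)) ^ 2 * h) =
      ((2 * φ + 1) * φ - 1 * -(3 * φ + 2)) ^ 2 *
        ((2 * φ + 1) ^ 2 * f + (-φ) ^ 2 * g + (-(φ + 1)) ^ 2 * h) ∧
      ((2 * φ + 1) * φ - 1 * -(3 * φ + 2)) ^ 2 *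
        ((2 * φ + 1) ^ 2 * f + (-φ) ^ 2 * g + (-(φ + 1)) ^ 2 * h) =
      (1 * -φ - (2 * φ + 1) * φ) ^ 2 *
        ((2 * φ + 1) ^ 2 * f + (-(3 * φ + 2)) ^ 2 * g + (φ + 1) ^ 2 * h)) ↔
      f = h ∧ g = h := by
  constructor
  · rintro ⟨h₁, h₂⟩
    constructor <;> grind
  · rintro ⟨rfl, rfl⟩
    constructor <;> grind

/-- The two CCP solution triangles `T1` and `T2` share their isodynamic points: the set of
points `P` with `x1·dist(P,V1) = y1·dist(P,V2) = z1·dist(P,V3)` equals the set of points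
`P` with `x2·dist(P,W1) = y2·dist(P,W2) = z2·dist(P,W3)`. -/
theorem ccp_solutions_share_isodynamic_points
    (A B C : EuclideanSpace ℝ (Fin 2)) (hABC : AffineIndependent ℝ ![A, B, C])
    (a b c s u v w φ : ℝ)
    (ha : a = dist B C) (hb : b = dist C A) (hc : c = dist A B)
    (hs : s = (a + b + c) / 2)
    (hu : u = s - a) (hv : v = s - b) (hw : w = s - c)
    (hφ : φ = (1 + Real.sqrt 5) / 2)
    (V1 V2 V3 : EuclideanSpace ℝ (Fin 2))
    (hV1 : V1 = bary A B C (φ ^ 2 / u) (1 / v) ((φ - 1) ^ 2 / w))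
    (hV2 : V2 = bary A B C ((φ - 2) ^ 2 / u) (1 / v) ((φ - 1) ^ 2 / w))
    (hV3 : V3 = bary A B C ((φ - 2) ^ 2 / u) ((2 * φ - 3) ^ 2 / v) ((φ - 1) ^ 2 / w))
    (W1 W2 W3 : EuclideanSpace ℝ (Fin 2))
    (hW1 : W1 = bary A B C (1 / u) (φ ^ 2 / v) ((φ + 1) ^ 2 / w))
    (hW2 : W2 = bary A B C ((2 * φ + 1) ^ 2 / u) (φ ^ 2 / v) ((φ + 1) ^ 2 / w))
    (hW3 : W3 = bary A B C ((2 * φ + 1) ^ 2 / u) ((3 * φ + 2) ^ 2 / v) ((φ + 1) ^ 2 / w))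
    (x1 y1 z1 x2 y2 z2 : ℝ)
    (hx1 : x1 = dist V2 V3) (hy1 : y1 = dist V3 V1) (hz1 : z1 = dist V1 V2)
    (hx2 : x2 = dist W2 W3) (hy2 : y2 = dist W3 W1) (hz2 : z2 = dist W1 W2) :
    {P : EuclideanSpace ℝ (Fin 2) |
        x1 * dist P V1 = y1 * dist P V2 ∧ y1 * dist P V2 = z1 * dist P V3} =
      {P : EuclideanSpace ℝ (Fin 2) |
        x2 * dist P W1 = y2 * dist P W2 ∧ y2 * dist P W2 = z2 * dist P W3} := by
  have hφ2 : φ ^ 2 = φ + 1 := by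
    rw [hφ]
    linear_combination (1 / 4 : ℝ) * Real.sq_sqrt (show (0 : ℝ) ≤ 5 by norm_num)
  have hφ1 : 1 < φ := by
    have : (1 : ℝ) < Real.sqrt 5 := Real.lt_sqrt_of_sq_lt (by norm_num)
    linarith
  have hu0 : 0 < u := by
    have := dist_lt_dist_add_dist_of_affineIndependent
      (A := B) (B := A) (C := C) (by
        rw [affineIndependent_iff_not_collinear_set] at hABC ⊢
        rwa [Set.insert_comm])
    rw [dist_comm B A, dist_comm A C] at this
    linarith
  have hv0 : 0 < v := by
    have := dist_lt_dist_add_dist_of_affineIndependent hABC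
    rw [dist_comm A C] at this
    linarith
  have hw0 : 0 < w := by
    have := dist_lt_dist_add_dist_of_affineIndependent
      (A := A) (B := C) (C := B) (by
        rw [affineIndependent_iff_not_collinear_set] at hABC ⊢
        rwa [Set.pair_comm])
    rw [dist_comm A C, dist_comm C B] at this
    linarith
  have ha' : dist B C = v + w := by linarith
  have hb' : dist C A = w + u := by linarith
  have hc' : dist A B = u + v := by linarith
  ext P
  simp only [Set.mem_ofPred_eq]
  rw [hx1, hy1, hz1, hx2, hy2, hz2,
    isodynamic_incircle_iff P A B C (p₁ := φ) (q₁ := -1) (r₁ := 1 - φ)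
      (p₂ := φ - 2) (q₂ := 1) (r₂ := 1 - φ) (p₃ := 2 - φ) (q₃ := 2 * φ - 3) (r₃ := 1 - φ)
      hu0 hv0 hw0 ha' hb' hc' (by ring) (by ring) (by ring) (by linarith) (by linarith)
      (by linarith) (by rw [hV1]; ring_nf) (by rw [hV2]; ring_nf) (by rw [hV3]; ring_nf),
    isodynamic_incircle_iff P A B C (p₁ := 1) (q₁ := φ) (r₁ := -(φ + 1))
      (p₂ := 2 * φ + 1) (q₂ := -φ) (r₂ := -(φ + 1))
      (p₃ := 2 * φ + 1) (q₃ := -(3 * φ + 2)) (r₃ := φ + 1)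
      hu0 hv0 hw0 ha' hb' hc' (by ring) (by ring) (by ring) (by linarith) (by linarith)
      (by linarith) (by rw [hW1]; ring_nf) (by rw [hW2]; ring_nf) (by rw [hW3]; ring_nf),
    golden_isodynamic_iff hφ2, golden_isodynamic_iff' hφ2]
end
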